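/- arXiv:2601.21300 — 2 statements merged into one kernel-verified Lean document; each statement's English description precedes it below -/
import Mathlib

section
/- Let a = (a_x, a_y) ∈ ℝ² and let α, β ∈ ℝ be headings with cos(α − β) ≠ 1. Define p₁ = (a_x sin β − a_y cos β)/(1 − cos(α − β)), p₂ = (a_x sin α − a_y cos α)/(1 − cos(α − β)), and p₃ = ((a_x sin((α+β)/2) − a_y cos((α+β)/2))/(1 − cos(α − β)))². For any r_A ∈ ℝ with r_A ≠ p₁ and any r_B ∈ ℝ, set o_A = (a_x + r_A sin α, a_y − r_A cos α) and o_B = (−r_B sin β, r_B cos β). Then the tangency condition ‖o_A − o_B‖² = (r_A + r_B)² holds if and only if r_B = p₃/(r_A − p₁) + p₂. -/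
open Real

/-- The product of the two linear forms at `α` and `β` in terms of the one at their mean. -/
theorem sq_linear_form_half_add (x y α β : ℝ) :
    (x * Real.sin ((α + β) / 2) - y * Real.cos ((α + β) / 2)) ^ 2 =
      (x ^ 2 + y ^ 2) * (1 - Real.cos (α - β)) / 2 +
        (x * Real.sin α - y * Real.cos α) * (x * Real.sin β - y * Real.cos β) := by
  obtain ⟨m, d, rfl, rfl⟩ : ∃ m d : ℝ, α = m + d ∧ β = m - d :=
    ⟨(α + β) / 2, (α - β) / 2, by ring, by ring⟩
  rw [show (m + d + (m - d)) / 2 = m by ring, show m + d - (m - d) = 2 * d by ring,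
    Real.cos_two_mul, Real.sin_add, Real.sin_sub, Real.cos_add, Real.cos_sub]
  have hm := Real.sin_sq_add_cos_sq m
  have hd := Real.sin_sq_add_cos_sq d
  generalize Real.sin m = s at *
  generalize Real.cos m = c at *
  generalize Real.sin d = t at *
  generalize Real.cos d = u at *
  linear_combination (x ^ 2 + y ^ 2) * (1 - u ^ 2) * hm +
    (x * c + y * s) ^ 2 * hd

/-- Lemma 2 (CC-trajectory tangency): for oriented points `A = ((a_x, a_y), α)` and
`B = (0, β)` with `cos (α - β) ≠ 1`, the circles of signed radii `r_A`, `r_B` with centres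
`o_A = (a_x + r_A sin α, a_y - r_A cos α)` and `o_B = (-r_B sin β, r_B cos β)` are tangent
(in the signed sense `‖o_A - o_B‖² = (r_A + r_B)²`) iff `r_B = p₃ / (r_A - p₁) + p₂`. -/
theorem cc_trajectory_tangency
    (ax ay α β : ℝ) (hcos : Real.cos (α - β) ≠ 1)
    (p₁ p₂ p₃ : ℝ)
    (hp₁ : p₁ = (ax * Real.sin β - ay * Real.cos β) / (1 - Real.cos (α - β)))
    (hp₂ : p₂ = (ax * Real.sin α - ay * Real.cos α) / (1 - Real.cos (α - β)))
    (hp₃ : p₃ = ((ax * Real.sin ((α + β) / 2) - ay * Real.cos ((α + β) / 2)) /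
        (1 - Real.cos (α - β))) ^ 2)
    (rA rB : ℝ) (hrA : rA ≠ p₁)
    (oA oB : EuclideanSpace ℝ (Fin 2))
    (hoA : oA = ![ax + rA * Real.sin α, ay - rA * Real.cos α])
    (hoB : oB = ![-(rB * Real.sin β), rB * Real.cos β]) :
    ‖oA - oB‖ ^ 2 = (rA + rB) ^ 2 ↔ rB = p₃ / (rA - p₁) + p₂ := by
  have hD : 1 - Real.cos (α - β) ≠ 0 := sub_ne_zero.mpr hcos.symm
  have hr : rA - p₁ ≠ 0 := sub_ne_zero.mpr hrA
  have hV : p₁ * (1 - Real.cos (α - β)) = ax * Real.sin β - ay * Real.cos β := by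
    rw [hp₁, div_mul_cancel₀ _ hD]
  have hU : p₂ * (1 - Real.cos (α - β)) = ax * Real.sin α - ay * Real.cos α := by
    rw [hp₂, div_mul_cancel₀ _ hD]
  have hW : p₃ * (1 - Real.cos (α - β)) ^ 2 =
      (ax ^ 2 + ay ^ 2) * (1 - Real.cos (α - β)) / 2 +
        (p₂ * (1 - Real.cos (α - β))) * (p₁ * (1 - Real.cos (α - β))) := by
    rw [hp₃, div_pow, div_mul_cancel₀ _ (pow_ne_zero 2 hD), hU, hV, sq_linear_form_half_add]
  have hW' : p₃ * (1 - Real.cos (α - β)) =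
      (ax ^ 2 + ay ^ 2) / 2 + p₁ * p₂ * (1 - Real.cos (α - β)) :=
    mul_right_cancel₀ hD (by linear_combination hW)
  have hnorm : ‖oA - oB‖ ^ 2 = (ax + rA * Real.sin α + rB * Real.sin β) ^ 2 +
      (ay - rA * Real.cos α - rB * Real.cos β) ^ 2 := by
    rw [EuclideanSpace.real_norm_sq_eq, Fin.sum_univ_two]
    simp [hoA, hoB]
  have key : ‖oA - oB‖ ^ 2 - (rA + rB) ^ 2 =
      2 * (1 - Real.cos (α - β)) * (p₃ - (rB - p₂) * (rA - p₁)) := by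
    rw [hnorm]
    linear_combination rA ^ 2 * Real.sin_sq_add_cos_sq α + rB ^ 2 * Real.sin_sq_add_cos_sq β -
      2 * rA * hU - 2 * rB * hV - 2 * hW' - 2 * rA * rB * Real.cos_sub α β
  rw [← sub_eq_zero, key, mul_eq_zero, or_iff_right (mul_ne_zero two_ne_zero hD), sub_eq_zero,
    ← sub_eq_iff_eq_add, eq_div_iff hr, eq_comm]
end

section
/- Let w, c ∈ ℂ with w ≠ 0. Suppose that for every θ ∈ ℝ, w·exp(i θ) − c ≠ 0 and Im( (i·w·exp(i θ)) / (w·exp(i θ) − c) ) = 1. Then c = 0. -/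
open Complex

/-- The line-of-sight condition at `z` says that `c` is orthogonal to `z - c`. -/
lemma re_mul_re_add_im_mul_im_of_im_div_eq_one {z c : ℂ} (hz : z - c ≠ 0)
    (h : ((I * z) / (z - c)).im = 1) :
    c.re * z.re + c.im * z.im = c.re ^ 2 + c.im ^ 2 := by
  have hn : normSq (z - c) ≠ 0 := normSq_eq_zero.not.mpr hz
  rw [div_im, ← sub_div, div_eq_one_iff_eq hn, normSq_apply] at h
  simp only [mul_im, mul_re, I_re, I_im, sub_re, sub_im] at h
  linarith

/-- If the LOS direction condition `Im(i w e^{iθ} / (w e^{iθ} - c)) = 1` holds for every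
angle `θ` (with the denominator never vanishing) and `w ≠ 0`, then `c = 0`. -/
theorem constant_los_angle_forces_center_zero
    (w c : ℂ) (hw : w ≠ 0)
    (h : ∀ θ : ℝ, w * Complex.exp (Complex.I * θ) - c ≠ 0 ∧
      ((Complex.I * (w * Complex.exp (Complex.I * θ))) /
        (w * Complex.exp (Complex.I * θ) - c)).im = 1) :
    c = 0 := by
  obtain ⟨h₀, h₀'⟩ := h 0
  obtain ⟨h₁, h₁'⟩ := h Real.pi
  have hpi : exp (I * Real.pi) = -1 := by rw [mul_comm, exp_pi_mul_I]
  simp only [ofReal_zero, mul_zero, exp_zero, mul_one] at h₀ h₀'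
  rw [hpi, mul_neg_one] at h₁ h₁'
  have e₀ := re_mul_re_add_im_mul_im_of_im_div_eq_one h₀ h₀'
  have e₁ := re_mul_re_add_im_mul_im_of_im_div_eq_one h₁ h₁'
  rw [neg_re, neg_im] at e₁
  rw [← normSq_eq_zero, normSq_apply]
  linarith
end
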